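/- Let f : ℝⁿ → ℝ be a convex L-smooth function (L > 0), let η ∈ (0, 2/L], and let (x_k) be the gradient descent iterates x_{k+1} = x_k - η • ∇f(x_k) from an arbitrary x_0 ∈ ℝⁿ. Then the sequence of gradient norms k ↦ ‖∇f(x_k)‖ is non-increasing. -/

import Mathlib

section SmoothConvex

variable {F : Type*} [NormedAddCommGroup F] [InnerProductSpace ℝ F] [CompleteSpace F]
  {f : F → ℝ} {L : ℝ}

theorem hasDerivAt_comp_add_smul_of_differentiableAt {x v : F} {t : ℝ}
    (hf : DifferentiableAt ℝ f (x + t • v)) :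
    HasDerivAt (fun s : ℝ => f (x + s • v)) (inner ℝ (gradient f (x + t • v)) v) t := by
  have hline : HasDerivAt (fun s : ℝ => x + s • v) v t := by
    simpa using ((hasDerivAt_id t).smul_const v).const_add x
  rw [inner_gradient_left]
  exact hf.hasFDerivAt.comp_hasDerivAt t hline

/-- The first-order characterization of convexity: the graph lies above its tangent planes. -/
theorem ConvexOn.add_inner_gradient_le (hconv : ConvexOn ℝ Set.univ f)
    (hdiff : Differentiable ℝ f) (x y : F) :
    f x + inner ℝ (gradient f x) (y - x) ≤ f y := by
  have hφ : ConvexOn ℝ Set.univ (fun t : ℝ => f (x + t • (y - x))) := by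
    have h := hconv.comp_affineMap (AffineMap.lineMap (k := ℝ) x y)
    rw [Set.preimage_univ] at h
    refine h.congr fun t _ => ?_
    simp [AffineMap.lineMap_apply, add_comm]
  have hd := hasDerivAt_comp_add_smul_of_differentiableAt (hdiff (x + (0 : ℝ) • (y - x)))
  have h := hφ.le_slope_of_hasDerivAt (Set.mem_univ 0) (Set.mem_univ 1) one_pos hd
  simp only [slope_def_field, zero_smul, one_smul, add_zero, add_sub_cancel, sub_zero,
    div_one] at h
  linarith

/-- The descent lemma: a function with `L`-Lipschitz gradient has a quadratic upper bound. -/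
theorem LipschitzWith.le_add_inner_gradient_add_sq (hL : 0 ≤ L) (hdiff : Differentiable ℝ f)
    (hlip : LipschitzWith L.toNNReal (gradient f)) (x y : F) :
    f y ≤ f x + inner ℝ (gradient f x) (y - x) + L / 2 * ‖y - x‖ ^ 2 := by
  set v := y - x with hv
  have hd (t : ℝ) : HasDerivAt
      (fun s : ℝ => f (x + s • v) - s * inner ℝ (gradient f x) v - L / 2 * ‖v‖ ^ 2 * s ^ 2)
      (inner ℝ (gradient f (x + t • v)) v - inner ℝ (gradient f x) v - L * ‖v‖ ^ 2 * t) t := by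
    refine HasDerivAt.congr_deriv
      (((hasDerivAt_comp_add_smul_of_differentiableAt (hdiff (x + t • v))).sub
      ((hasDerivAt_id t).mul_const (inner ℝ (gradient f x) v))).sub
      ((hasDerivAt_pow 2 t).const_mul (L / 2 * ‖v‖ ^ 2))) ?_
    push_cast
    ring
  have hanti := antitoneOn_of_hasDerivWithinAt_nonpos (convex_Icc (0 : ℝ) 1)
    (fun t _ => (hd t).continuousAt.continuousWithinAt) (fun t _ => (hd t).hasDerivWithinAt)
    (fun t ht => by
      rw [interior_Icc] at ht
      have hgrad : ‖gradient f (x + t • v) - gradient f x‖ ≤ L * (t * ‖v‖) := by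
        have h := hlip.norm_sub_le (x + t • v) x
        rwa [Real.coe_toNNReal L hL, add_sub_cancel_left, norm_smul,
          Real.norm_of_nonneg ht.1.le] at h
      have h := real_inner_le_norm (gradient f (x + t • v) - gradient f x) v
      rw [inner_sub_left] at h
      nlinarith [mul_le_mul_of_nonneg_right hgrad (norm_nonneg v)])
  have h := hanti (Set.left_mem_Icc.2 zero_le_one) (Set.right_mem_Icc.2 zero_le_one) zero_le_one
  simp only [zero_smul, one_smul, add_zero] at h
  rw [hv, add_sub_cancel, ← hv] at h
  linarith

theorem ConvexOn.add_inner_gradient_add_sq_le (hL : 0 < L) (hconv : ConvexOn ℝ Set.univ f)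
    (hdiff : Differentiable ℝ f) (hlip : LipschitzWith L.toNNReal (gradient f)) (x y : F) :
    f x + inner ℝ (gradient f x) (y - x) + 1 / (2 * L) * ‖gradient f y - gradient f x‖ ^ 2
      ≤ f y := by
  set d := gradient f y - gradient f x with hd
  have hlower := hconv.add_inner_gradient_le hdiff x (y - L⁻¹ • d)
  have hupper := hlip.le_add_inner_gradient_add_sq hL.le hdiff y (y - L⁻¹ • d)
  have hinner : inner ℝ (gradient f y) d - inner ℝ (gradient f x) d = ‖d‖ ^ 2 := by
    rw [← inner_sub_left, ← hd, real_inner_self_eq_norm_sq]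
  rw [sub_right_comm, inner_sub_right, real_inner_smul_right] at hlower
  rw [sub_sub_cancel_left, inner_neg_right, real_inner_smul_right, norm_neg, norm_smul,
    Real.norm_of_nonneg (inv_nonneg.2 hL.le)] at hupper
  have hsq : L / 2 * (L⁻¹ * ‖d‖) ^ 2 = L⁻¹ * ‖d‖ ^ 2 - 1 / (2 * L) * ‖d‖ ^ 2 := by
    field_simp
    ring
  rw [hsq, ← hinner] at hupper
  rw [← hinner]
  linarith

/-- The Baillon–Haddad theorem: the gradient of a convex `L`-smooth function is
`1 / L`-cocoercive. -/
theorem ConvexOn.norm_gradient_sub_sq_le (hL : 0 < L) (hconv : ConvexOn ℝ Set.univ f)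
    (hdiff : Differentiable ℝ f) (hlip : LipschitzWith L.toNNReal (gradient f)) (x y : F) :
    ‖gradient f y - gradient f x‖ ^ 2 ≤ L * inner ℝ (gradient f y - gradient f x) (y - x) := by
  have hxy := hconv.add_inner_gradient_add_sq_le hL hdiff hlip x y
  have hyx := hconv.add_inner_gradient_add_sq_le hL hdiff hlip y x
  rw [norm_sub_rev, ← neg_sub y x, inner_neg_right] at hyx
  rw [← inv_mul_le_iff₀ hL, inner_sub_left]
  have hhalf : 1 / (2 * L) = L⁻¹ / 2 := by
    field_simp
  rw [hhalf] at hxy hyx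
  linarith

theorem ConvexOn.norm_gradient_sub_smul_gradient_le (hL : 0 < L)
    (hconv : ConvexOn ℝ Set.univ f) (hdiff : Differentiable ℝ f)
    (hlip : LipschitzWith L.toNNReal (gradient f)) {η : ℝ} (hη : η ∈ Set.Ioc 0 (2 / L)) (x : F) :
    ‖gradient f (x - η • gradient f x)‖ ≤ ‖gradient f x‖ := by
  have hco := hconv.norm_gradient_sub_sq_le hL hdiff hlip x (x - η • gradient f x)
  set a := gradient f x
  set b := gradient f (x - η • a)
  rw [sub_sub_cancel_left, inner_neg_right, real_inner_smul_right] at hco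
  have hLη : η * L ≤ 2 := (le_div_iff₀ hL).1 hη.2
  have hpos : 0 < η * L := mul_pos hη.1 hL
  have hnonpos : inner ℝ (b - a) a ≤ 0 := by
    by_contra! h
    nlinarith [mul_pos hpos h, sq_nonneg ‖b - a‖]
  have hexpand : ‖b‖ ^ 2 = ‖b - a‖ ^ 2 + 2 * inner ℝ (b - a) a + ‖a‖ ^ 2 := by
    rw [← norm_add_sq_real, sub_add_cancel]
  apply (sq_le_sq₀ (norm_nonneg b) (norm_nonneg a)).1
  nlinarith [mul_nonneg (sub_nonneg.2 hLη) (neg_nonneg.2 hnonpos)]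

end SmoothConvex

/-- For a convex `L`-smooth `f` and step size `η ∈ (0, 2/L]`, the gradient norms
along gradient descent are non-increasing. -/
theorem gradientDescent_gradNorm_antitone
    {n : ℕ} (f : EuclideanSpace ℝ (Fin n) → ℝ) (L : ℝ) (hL : 0 < L)
    (hconv : ConvexOn ℝ Set.univ f) (hdiff : Differentiable ℝ f)
    (hlip : LipschitzWith L.toNNReal (gradient f))
    (η : ℝ) (hη : η ∈ Set.Ioc 0 (2 / L))
    (x : ℕ → EuclideanSpace ℝ (Fin n))
    (hx : ∀ k : ℕ, x (k + 1) = x k - η • gradient f (x k)) :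
    Antitone (fun k : ℕ => ‖gradient f (x k)‖) := by
  refine antitone_nat_of_succ_le fun k => ?_
  rw [hx k]
  exact hconv.norm_gradient_sub_smul_gradient_le hL hdiff hlip hη (x k)
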